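/- arXiv:2304.00588 — 3 statements merged into one kernel-verified Lean document; each statement's English description precedes it below -/
import Mathlib

section
/- For all natural numbers m > 0 and n ≥ 0, the extended Grundy value of the component socket^m ++ bulb^n is: n if m is even; n+1 if m is odd and n is even; and n-1 if m is odd and n is odd. In particular this value is always finite. -/
/-- A piece of a Christmas lights' fixture: a (broken-but-replaceable) bulb
or a (broken) socket. -/
inductive Piece : Type
  | bulb : Piece
  | socket : Piece
  deriving DecidableEq

/-- A component is a finite list of pieces; index 0 is nearest the plug. -/
abbrev Component := List Piece

/-- A sequence of `n` bulbs. -/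
def bulbs (n : ℕ) : Component := List.replicate n Piece.bulb

/-- A sequence of `m` sockets. -/
def sockets (m : ℕ) : Component := List.replicate m Piece.socket

/-- The entries at positions `i-1` and `i+1` both exist and both equal bulb. -/
def Sandwiched (L : Component) (i : ℕ) : Prop :=
  0 < i ∧ L[i-1]? = some Piece.bulb ∧ L[i+1]? = some Piece.bulb

/-- `L'` is obtained from `L` by a quiet move: either fix a bulb (truncating
everything to its right), or remove a socket that is not sandwiched between
two bulbs. -/
def QuietOption (L L' : Component) : Prop :=
  (∃ i, L[i]? = some Piece.bulb ∧ L' = L.take i) ∨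
  (∃ i, L[i]? = some Piece.socket ∧ ¬ Sandwiched L i ∧ L' = L.eraseIdx i)

/-- `L'` is obtained from `L` by a carry-on move: remove a socket sandwiched
between two bulbs (the mover must move again). -/
def CarryOption (L L' : Component) : Prop :=
  ∃ i, L[i]? = some Piece.socket ∧ Sandwiched L i ∧ L' = L.eraseIdx i

/-- A position is a finite multiset of components. -/
abbrev Position := Multiset Component

/-- Total number of pieces in a position. -/
def Position.size (pos : Position) : ℕ := (pos.map List.length).sum

/-- Fuel-indexed winning predicate; `WinN n pos` agrees with the intended
`Win pos` whenever `n ≥ Position.size pos`, since every move strictly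
decreases the total number of pieces. -/
def WinN : ℕ → Position → Prop
  | 0, _ => False
  | n+1, pos =>
      (∃ L ∈ pos, ∃ L', QuietOption L L' ∧ ¬ WinN n (L' ::ₘ pos.erase L)) ∨
      (∃ L ∈ pos, ∃ L', CarryOption L L' ∧ WinN n (L' ::ₘ pos.erase L))

/-- The player to move wins `pos` (normal play convention): some quiet move
leads to a losing position for the opponent, or some carry-on move leads to a
position the mover (still to move) wins. -/
def Win (pos : Position) : Prop := WinN (Position.size pos) pos

open Classical in
/-- Fuel-indexed extended Grundy value; `gN n L` agrees with the intended
value whenever `n ≥ L.length`, since every option of `L` is strictly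
shorter. -/
noncomputable def gN : ℕ → Component → ℕ∞
  | 0, _ => 0
  | n+1, L =>
      let S : Set ℕ := {k | ∃ L', QuietOption L L' ∧ gN n L' = (k : ℕ∞)}
      let C : Set ℕ∞ := {v | ∃ L', CarryOption L L' ∧ gN n L' = v}
      if (⊤ : ℕ∞) ∈ C ∨ (∃ a ∈ C, ∃ b ∈ C, a ≠ b) ∨
          (∃ k : ℕ, C = {(k : ℕ∞)} ∧ k ∈ S) then ⊤
      else if h : ∃ k : ℕ, C = {(k : ℕ∞)} ∧ k ∉ S then (h.choose : ℕ∞)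
      else ((sInf {k : ℕ | k ∉ S} : ℕ) : ℕ∞)

/-- The extended Grundy value `g L ∈ ℕ ∪ {∞}` of a component. -/
noncomputable def g (L : Component) : ℕ∞ := gN L.length L

/-- A component is bulb-headed if it is empty or its first piece is a bulb. -/
def BulbHeaded (L : Component) : Prop := L = [] ∨ L.head? = some Piece.bulb

theorem getElem?_sockets_append_bulbs_eq_bulb {m n i : ℕ} :
    (sockets m ++ bulbs n)[i]? = some Piece.bulb ↔ m ≤ i ∧ i < m + n := by
  simp only [sockets, bulbs, List.getElem?_append, List.length_replicate, List.getElem?_replicate]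
  split_ifs <;> simp <;> omega

theorem getElem?_sockets_append_bulbs_eq_socket {m n i : ℕ} :
    (sockets m ++ bulbs n)[i]? = some Piece.socket ↔ i < m := by
  simp only [sockets, bulbs, List.getElem?_append, List.length_replicate, List.getElem?_replicate]
  split_ifs <;> simp_all

theorem take_sockets_append_bulbs {m n i : ℕ} (hi : i ≤ n) :
    (sockets m ++ bulbs n).take (m + i) = sockets m ++ bulbs i := by
  simp [sockets, bulbs, List.take_append, hi]

theorem eraseIdx_sockets_append_bulbs {m n i : ℕ} (hi : i < m + 1) :
    (sockets (m + 1) ++ bulbs n).eraseIdx i = sockets m ++ bulbs n := by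
  rw [List.eraseIdx_append_of_lt_length (by simpa [sockets] using hi)]
  simp [sockets, List.eraseIdx_replicate, hi]

theorem not_sandwiched_sockets_append_bulbs {m n i : ℕ} (hi : i < m) :
    ¬ Sandwiched (sockets m ++ bulbs n) i := by
  rintro ⟨_, h, _⟩
  rw [getElem?_sockets_append_bulbs_eq_bulb] at h
  omega

theorem not_carryOption_sockets_append_bulbs {m n : ℕ} {L : Component} :
    ¬ CarryOption (sockets m ++ bulbs n) L := by
  rintro ⟨i, hi, hs, _⟩
  exact not_sandwiched_sockets_append_bulbs (getElem?_sockets_append_bulbs_eq_socket.1 hi) hs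

theorem quietOption_sockets_append_bulbs_iff {m n : ℕ} {L : Component} :
    QuietOption (sockets m ++ bulbs n) L ↔
      (∃ i < n, L = sockets m ++ bulbs i) ∨ ∃ l, m = l + 1 ∧ L = sockets l ++ bulbs n := by
  simp only [QuietOption, getElem?_sockets_append_bulbs_eq_bulb,
    getElem?_sockets_append_bulbs_eq_socket]
  constructor
  · rintro (⟨i, ⟨hmi, hi⟩, rfl⟩ | ⟨i, hi, _, rfl⟩)
    · obtain ⟨j, rfl⟩ := Nat.exists_eq_add_of_le hmi
      exact .inl ⟨j, by omega, take_sockets_append_bulbs (by omega)⟩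
    · obtain ⟨l, rfl⟩ := Nat.exists_eq_add_one_of_ne_zero (by omega : m ≠ 0)
      exact .inr ⟨l, rfl, eraseIdx_sockets_append_bulbs hi⟩
  · rintro (⟨i, hi, rfl⟩ | ⟨l, rfl, rfl⟩)
    · exact .inl ⟨m + i, by omega, (take_sockets_append_bulbs hi.le).symm⟩
    · exact .inr ⟨0, by omega, not_sandwiched_sockets_append_bulbs (by omega),
        (eraseIdx_sockets_append_bulbs (by omega)).symm⟩

theorem gN_succ_of_forall_not_carryOption (k : ℕ) {L : Component}
    (h : ∀ L', ¬ CarryOption L L') :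
    gN (k + 1) L =
      ((sInf {j : ℕ | ¬ ∃ L', QuietOption L L' ∧ gN k L' = (j : ℕ∞)} : ℕ) : ℕ∞) := by
  have hne : ∀ j : ℕ, (∅ : Set ℕ∞) ≠ {(j : ℕ∞)} := fun j =>
    (Set.singleton_nonempty _).ne_empty.symm
  rw [gN, if_neg (by simp [h, hne]), dif_neg (by simp [h, hne])]
  rfl

theorem Nat.sInf_setOf_not_eq {p : ℕ → Prop} {v : ℕ} (hv : ¬ p v) (hlt : ∀ j < v, p j) :
    sInf {j | ¬ p j} = v :=
  le_antisymm (Nat.sInf_le hv) <|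
    le_csInf ⟨v, hv⟩ fun j hj => not_lt.1 fun hjv => hj (hlt j hjv)

/-- The Grundy value of `m` sockets followed by `n` bulbs. -/
def socketsBulbsValue (m n : ℕ) : ℕ :=
  if Even m then n else if Even n then n + 1 else n - 1

theorem gN_sockets_append_bulbs {k m n : ℕ} (hk : m + n ≤ k) :
    gN k (sockets m ++ bulbs n) = (socketsBulbsValue m n : ℕ∞) := by
  induction k generalizing m n with
  | zero =>
    obtain ⟨rfl, rfl⟩ : m = 0 ∧ n = 0 := by omega
    simp [gN, socketsBulbsValue]
  | succ k ih =>
    have key : ∀ j : ℕ,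
        (∃ L', QuietOption (sockets m ++ bulbs n) L' ∧ gN k L' = (j : ℕ∞)) ↔
          (∃ i < n, socketsBulbsValue m i = j) ∨
            ∃ l, m = l + 1 ∧ socketsBulbsValue l n = j := by
      intro j
      simp only [quietOption_sockets_append_bulbs_iff]
      constructor
      · rintro ⟨L', ⟨i, hi, rfl⟩ | ⟨l, rfl, rfl⟩, hL⟩
        · rw [ih (by omega)] at hL
          exact .inl ⟨i, hi, by exact_mod_cast hL⟩
        · rw [ih (by omega)] at hL
          exact .inr ⟨l, rfl, by exact_mod_cast hL⟩
      · rintro (⟨i, hi, rfl⟩ | ⟨l, rfl, rfl⟩)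
        · exact ⟨_, .inl ⟨i, hi, rfl⟩, ih (by omega)⟩
        · exact ⟨_, .inr ⟨l, rfl, rfl⟩, ih (by omega)⟩
    rw [gN_succ_of_forall_not_carryOption k fun _ => not_carryOption_sockets_append_bulbs]
    simp only [key]
    rw [Nat.sInf_setOf_not_eq]
    · simp only [socketsBulbsValue, Nat.even_iff]
      rintro (⟨i, hi, h⟩ | ⟨l, rfl, h⟩) <;> split_ifs at h <;> omega
    · intro j hj
      simp only [socketsBulbsValue, Nat.even_iff] at hj ⊢
      by_cases hm : m % 2 = 0
      · simp only [hm, if_true] at hj ⊢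
        exact .inl ⟨j, hj, rfl⟩
      · simp only [hm, if_false] at hj ⊢
        by_cases hjn : j = n
        · exact .inr ⟨m - 1, by omega, by rw [if_pos (by omega), hjn]⟩
        · by_cases hj2 : j % 2 = 0
          · exact .inl ⟨j + 1, by split_ifs at hj <;> omega, by rw [if_neg (by omega)]; rfl⟩
          · exact .inl ⟨j - 1, by split_ifs at hj <;> omega, by rw [if_pos (by omega)]; omega⟩

/-- For `m > 0`, the extended Grundy value of `socket^m ++ bulb^n`
is `n` if `m` is even, `n+1` if `m` is odd and `n` is even, and `n-1` if `m`
and `n` are both odd; in particular it is always finite. -/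
theorem stmt0 (m n : ℕ) (hm : 0 < m) :
    g (sockets m ++ bulbs n) ≠ ⊤ ∧
    g (sockets m ++ bulbs n) =
      (if Even m then ((n : ℕ) : ℕ∞)
       else if Even n then ((n + 1 : ℕ) : ℕ∞)
       else ((n - 1 : ℕ) : ℕ∞)) := by
  have h : g (sockets m ++ bulbs n) = (socketsBulbsValue m n : ℕ∞) :=
    gN_sockets_append_bulbs (by simp [sockets, bulbs])
  refine ⟨h ▸ ENat.natCast_ne_top _, ?_⟩
  rw [h, socketsBulbsValue]
  split_ifs <;> rfl
end

section
/- For all natural numbers k > 0 and m > 0, the extended Grundy value of the component bulb^k ++ socket^m ++ bulb^1 is: ∞ if m = 1; k if m > 1 is odd; and k+1 if m is even. -/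
/-- The component `bulb^k ++ socket^m ++ bulb^e`. -/
def bulbsSocketsBulbs (k m e : ℕ) : Component := bulbs k ++ sockets m ++ bulbs e

theorem bulbsSocketsBulbs_getElem? (k m e i : ℕ) :
    (bulbsSocketsBulbs k m e)[i]? =
      if i < k then some Piece.bulb
      else if i < k + m then some Piece.socket
      else if i < k + m + e then some Piece.bulb
      else none := by
  simp only [bulbsSocketsBulbs, bulbs, sockets, List.getElem?_append, List.length_append,
    List.length_replicate, List.getElem?_replicate]
  grind

theorem bulbsSocketsBulbs_take_of_lt {k i : ℕ} (m e : ℕ) (h : i < k) :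
    (bulbsSocketsBulbs k m e).take i = bulbsSocketsBulbs i 0 0 := by
  apply List.ext_getElem?
  intro j
  rw [List.getElem?_take, bulbsSocketsBulbs_getElem?, bulbsSocketsBulbs_getElem?]
  grind

theorem bulbsSocketsBulbs_take_add {e j : ℕ} (k m : ℕ) (h : j < e) :
    (bulbsSocketsBulbs k m e).take (k + m + j) = bulbsSocketsBulbs k m j := by
  apply List.ext_getElem?
  intro l
  rw [List.getElem?_take, bulbsSocketsBulbs_getElem?, bulbsSocketsBulbs_getElem?]
  grind

theorem bulbsSocketsBulbs_eraseIdx {k m i : ℕ} (e : ℕ) (h₁ : k ≤ i) (h₂ : i < k + m) :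
    (bulbsSocketsBulbs k m e).eraseIdx i = bulbsSocketsBulbs k (m - 1) e := by
  apply List.ext_getElem?
  intro l
  rw [List.getElem?_eraseIdx]
  simp only [bulbsSocketsBulbs_getElem?]
  grind

theorem bulbsSocketsBulbs_getElem?_eq_socket {k m e i : ℕ} :
    (bulbsSocketsBulbs k m e)[i]? = some Piece.socket ↔ k ≤ i ∧ i < k + m := by
  rw [bulbsSocketsBulbs_getElem?]
  grind

theorem bulbsSocketsBulbs_getElem?_eq_bulb {k m e i : ℕ} :
    (bulbsSocketsBulbs k m e)[i]? = some Piece.bulb ↔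
      i < k ∨ (k + m ≤ i ∧ i < k + m + e) := by
  rw [bulbsSocketsBulbs_getElem?]
  grind

theorem sandwiched_bulbsSocketsBulbs {k m e i : ℕ} (h₁ : k ≤ i) (h₂ : i < k + m) :
    Sandwiched (bulbsSocketsBulbs k m e) i ↔ m = 1 ∧ 0 < e ∧ 0 < k := by
  simp only [Sandwiched, bulbsSocketsBulbs_getElem?_eq_bulb]
  omega

theorem quietOption_bulbsSocketsBulbs {k m e : ℕ} {L : Component} :
    QuietOption (bulbsSocketsBulbs k m e) L ↔
      (∃ i < k, L = bulbsSocketsBulbs i 0 0) ∨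
      (∃ j < e, L = bulbsSocketsBulbs k m j) ∨
      (0 < m ∧ ¬ (m = 1 ∧ 0 < e ∧ 0 < k) ∧ L = bulbsSocketsBulbs k (m - 1) e) := by
  constructor
  · rintro (⟨i, hi, rfl⟩ | ⟨i, hi, hs, rfl⟩)
    · rcases bulbsSocketsBulbs_getElem?_eq_bulb.1 hi with h | ⟨h₁, h₂⟩
      · exact .inl ⟨i, h, bulbsSocketsBulbs_take_of_lt m e h⟩
      · obtain ⟨j, rfl⟩ := Nat.exists_eq_add_of_le h₁
        have hj : j < e := by omega
        exact .inr (.inl ⟨j, hj, bulbsSocketsBulbs_take_add k m hj⟩)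
    · obtain ⟨h₁, h₂⟩ := bulbsSocketsBulbs_getElem?_eq_socket.1 hi
      rw [sandwiched_bulbsSocketsBulbs h₁ h₂] at hs
      exact .inr (.inr ⟨by omega, hs, bulbsSocketsBulbs_eraseIdx e h₁ h₂⟩)
  · rintro (⟨i, hi, rfl⟩ | ⟨j, hj, rfl⟩ | ⟨hm, hs, rfl⟩)
    · exact .inl ⟨i, bulbsSocketsBulbs_getElem?_eq_bulb.2 (.inl hi),
        (bulbsSocketsBulbs_take_of_lt m e hi).symm⟩
    · exact .inl ⟨k + m + j, bulbsSocketsBulbs_getElem?_eq_bulb.2 (by omega),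
        (bulbsSocketsBulbs_take_add k m hj).symm⟩
    · have h : k < k + m := by omega
      exact .inr ⟨k, bulbsSocketsBulbs_getElem?_eq_socket.2 ⟨le_rfl, h⟩,
        by rwa [sandwiched_bulbsSocketsBulbs le_rfl h],
        (bulbsSocketsBulbs_eraseIdx e le_rfl h).symm⟩

theorem carryOption_bulbsSocketsBulbs {k m e : ℕ} {L : Component} :
    CarryOption (bulbsSocketsBulbs k m e) L ↔
      (m = 1 ∧ 0 < e ∧ 0 < k) ∧ L = bulbsSocketsBulbs k (m - 1) e := by
  constructor
  · rintro ⟨i, hi, hs, rfl⟩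
    obtain ⟨h₁, h₂⟩ := bulbsSocketsBulbs_getElem?_eq_socket.1 hi
    exact ⟨(sandwiched_bulbsSocketsBulbs h₁ h₂).1 hs, bulbsSocketsBulbs_eraseIdx e h₁ h₂⟩
  · rintro ⟨hs, rfl⟩
    have h : k < k + m := by omega
    exact ⟨k, bulbsSocketsBulbs_getElem?_eq_socket.2 ⟨le_rfl, h⟩,
      (sandwiched_bulbsSocketsBulbs le_rfl h).2 hs,
      (bulbsSocketsBulbs_eraseIdx e le_rfl h).symm⟩

/-- Without carry-on options the value is the least excluded value of the quiet options. -/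
theorem gN_succ_eq_of_mex {n v : ℕ} {L : Component} (hC : ∀ L', ¬ CarryOption L L')
    (hlt : ∀ j < v, ∃ L', QuietOption L L' ∧ gN n L' = (j : ℕ∞))
    (hne : ∀ L', QuietOption L L' → gN n L' ≠ (v : ℕ∞)) : gN (n + 1) L = (v : ℕ∞) := by
  have hempty : {w : ℕ∞ | ∃ L', CarryOption L L' ∧ gN n L' = w} = ∅ := by
    ext w
    simp [hC]
  have hmex : sInf {j : ℕ | j ∉ {j : ℕ | ∃ L', QuietOption L L' ∧ gN n L' = (j : ℕ∞)}} = v := by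
    have hmem : v ∈ {j : ℕ | j ∉ {j : ℕ | ∃ L', QuietOption L L' ∧ gN n L' = (j : ℕ∞)}} := by
      rintro ⟨L', hq, h⟩
      exact hne L' hq h
    refine le_antisymm (Nat.sInf_le hmem) (le_csInf ⟨v, hmem⟩ fun j hj => ?_)
    by_contra! h
    exact hj (hlt j h)
  have hnot : ∀ j : ℕ, {w : ℕ∞ | ∃ L', CarryOption L L' ∧ gN n L' = w} ≠ {(j : ℕ∞)} :=
    fun j => hempty ▸ (Set.singleton_nonempty _).ne_empty.symm
  simp only [gN]
  rw [if_neg, dif_neg, hmex]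
  · rintro ⟨j, hj, -⟩
    exact hnot j hj
  · rintro (h | ⟨a, h, -⟩ | ⟨j, hj, -⟩)
    · exact (hempty ▸ h : ⊤ ∈ (∅ : Set ℕ∞))
    · exact (hempty ▸ h : a ∈ (∅ : Set ℕ∞))
    · exact hnot j hj

/-- The value is `∞` when the unique carry-on value is also a quiet value. -/
theorem gN_succ_eq_top {n v : ℕ} {L L₁ L₂ : Component} (hC : ∀ L', CarryOption L L' ↔ L' = L₁)
    (h₁ : gN n L₁ = (v : ℕ∞)) (hq : QuietOption L L₂) (h₂ : gN n L₂ = (v : ℕ∞)) :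
    gN (n + 1) L = ⊤ := by
  simp only [gN]
  refine if_pos (.inr (.inr ⟨v, ?_, L₂, hq, h₂⟩))
  ext w
  simp [hC, h₁, eq_comm]

theorem gN_bulbs {n k : ℕ} (h : k ≤ n) : gN n (bulbsSocketsBulbs k 0 0) = (k : ℕ∞) := by
  induction n generalizing k with
  | zero => simp [gN, Nat.le_zero.1 h]
  | succ n ih =>
    apply gN_succ_eq_of_mex
    · simp [carryOption_bulbsSocketsBulbs]
    · exact fun j hj => ⟨_, quietOption_bulbsSocketsBulbs.2 (.inl ⟨j, hj, rfl⟩), ih (by omega)⟩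
    · intro L hL
      rcases quietOption_bulbsSocketsBulbs.1 hL with ⟨i, hi, rfl⟩ | ⟨j, hj, -⟩ | ⟨hm, -⟩
      · rw [ih (by omega)]
        exact_mod_cast hi.ne
      · omega
      · omega

theorem gN_bulbs_sockets {n k m : ℕ} (h : k + m ≤ n) :
    gN n (bulbsSocketsBulbs k m 0) = ((if Even m then k else k + 1 : ℕ) : ℕ∞) := by
  induction m generalizing n with
  | zero => simpa using gN_bulbs h
  | succ m ih =>
    obtain ⟨n, rfl⟩ : ∃ n', n = n' + 1 := ⟨n - 1, by omega⟩
    have hlast : QuietOption (bulbsSocketsBulbs k (m + 1) 0) (bulbsSocketsBulbs k m 0) :=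
      quietOption_bulbsSocketsBulbs.2 (.inr (.inr ⟨by omega, by omega, rfl⟩))
    apply gN_succ_eq_of_mex
    · simp [carryOption_bulbsSocketsBulbs]
    · intro j hj
      by_cases hjk : j < k
      · exact ⟨_, quietOption_bulbsSocketsBulbs.2 (.inl ⟨j, hjk, rfl⟩), gN_bulbs (by omega)⟩
      · refine ⟨_, hlast, ?_⟩
        rw [ih (by omega), Nat.cast_inj]
        grind
    · intro L hL
      rcases quietOption_bulbsSocketsBulbs.1 hL with ⟨i, hi, rfl⟩ | ⟨j, hj, -⟩ | ⟨-, -, rfl⟩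
      · rw [gN_bulbs (by omega), Ne, Nat.cast_inj]
        grind
      · omega
      · rw [Nat.add_sub_cancel, ih (by omega), Ne, Nat.cast_inj]
        grind

theorem bulbsSocketsBulbs_zero_one (k : ℕ) :
    bulbsSocketsBulbs k 0 1 = bulbsSocketsBulbs (k + 1) 0 0 := by
  simp [bulbsSocketsBulbs, bulbs, sockets, List.replicate_succ']

theorem gN_bulbs_sockets_bulb {n k m : ℕ} (hk : 0 < k) (hm : 0 < m) (h : k + m + 1 ≤ n) :
    gN n (bulbsSocketsBulbs k m 1) =
      (if m = 1 then (⊤ : ℕ∞)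
       else if Odd m then ((k : ℕ) : ℕ∞)
       else ((k + 1 : ℕ) : ℕ∞)) := by
  induction m, hm using Nat.le_induction generalizing n with
  | base =>
    obtain ⟨n, rfl⟩ : ∃ n', n = n' + 1 := ⟨n - 1, by omega⟩
    rw [if_pos rfl]
    refine gN_succ_eq_top (v := k + 1) (L₁ := bulbsSocketsBulbs (k + 1) 0 0)
      (L₂ := bulbsSocketsBulbs k 1 0) (fun L' => ?_) (gN_bulbs (by omega))
      (quietOption_bulbsSocketsBulbs.2 (.inr (.inl ⟨0, one_pos, rfl⟩))) ?_
    · simp [carryOption_bulbsSocketsBulbs, hk, bulbsSocketsBulbs_zero_one]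
    · simp [gN_bulbs_sockets (show k + 1 ≤ n by omega)]
  | succ m hm ih =>
    obtain ⟨n, rfl⟩ : ∃ n', n = n' + 1 := ⟨n - 1, by omega⟩
    have hbulb : QuietOption (bulbsSocketsBulbs k (m + 1) 1) (bulbsSocketsBulbs k (m + 1) 0) :=
      quietOption_bulbsSocketsBulbs.2 (.inr (.inl ⟨0, one_pos, rfl⟩))
    rw [if_neg (by omega), ← Nat.cast_ite]
    apply gN_succ_eq_of_mex
    · intro L'
      rw [carryOption_bulbsSocketsBulbs]
      omega
    · intro j hj
      by_cases hjk : j < k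
      · exact ⟨_, quietOption_bulbsSocketsBulbs.2 (.inl ⟨j, hjk, rfl⟩), gN_bulbs (by omega)⟩
      · refine ⟨_, hbulb, ?_⟩
        rw [gN_bulbs_sockets (by omega), Nat.cast_inj]
        grind
    · intro L hL
      rcases quietOption_bulbsSocketsBulbs.1 hL with ⟨i, hi, rfl⟩ | ⟨j, hj, rfl⟩ | ⟨-, -, rfl⟩
      · rw [gN_bulbs (by omega), Ne, Nat.cast_inj]
        grind
      · obtain rfl : j = 0 := by omega
        rw [gN_bulbs_sockets (by omega), Ne, Nat.cast_inj]
        grind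
      · rw [Nat.add_sub_cancel, ih (by omega)]
        by_cases hm1 : m = 1
        · rw [if_pos hm1]
          exact ENat.top_ne_natCast _
        · rw [if_neg hm1, ← Nat.cast_ite, Ne, Nat.cast_inj]
          grind

/-- For `k > 0` and `m > 0`, the extended Grundy value of
`bulb^k ++ socket^m ++ bulb^1` is `∞` if `m = 1`, `k` if `m > 1` is odd, and
`k+1` if `m` is even. -/
theorem stmt2 (k m : ℕ) (hk : 0 < k) (hm : 0 < m) :
    g (bulbs k ++ sockets m ++ bulbs 1) =
      (if m = 1 then (⊤ : ℕ∞)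
       else if Odd m then ((k : ℕ) : ℕ∞)
       else ((k + 1 : ℕ) : ℕ∞)) := by
  refine gN_bulbs_sockets_bulb hk hm ?_
  simp [bulbs, sockets]
end

section
/- Let i < s be natural numbers, let L be a bulb-headed component with g(L) = i and let M be a bulb-headed component with g(M) = s. Then the player to move wins the two-component position consisting of L and M, i.e., Win({L, M}) holds. -/
theorem QuietOption.length_lt {L L' : Component} (h : QuietOption L L') :
    L'.length < L.length := by
  rcases h with ⟨i, hi, rfl⟩ | ⟨i, hi, -, rfl⟩
  all_goals
    obtain ⟨hlt, -⟩ := List.getElem?_eq_some_iff.mp hi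
    grind

theorem CarryOption.length_lt {L L' : Component} (h : CarryOption L L') :
    L'.length < L.length := by
  obtain ⟨i, hi, -, rfl⟩ := h
  obtain ⟨hlt, -⟩ := List.getElem?_eq_some_iff.mp hi
  grind

theorem finite_quietOption (L : Component) : {L' | QuietOption L L'}.Finite := by
  refine (((Set.finite_lt_nat L.length).image L.take).union
    ((Set.finite_lt_nat L.length).image L.eraseIdx)).subset ?_
  rintro L' (⟨i, hi, rfl⟩ | ⟨i, hi, -, rfl⟩)
  · exact Or.inl ⟨i, (List.getElem?_eq_some_iff.mp hi).1, rfl⟩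
  · exact Or.inr ⟨i, (List.getElem?_eq_some_iff.mp hi).1, rfl⟩

open Classical in
/-- The extended Grundy value obtained from the set `S` of finite values of quiet options and the
set `C` of values of carry-on options. -/
noncomputable def extendedMex (S : Set ℕ) (C : Set ℕ∞) : ℕ∞ :=
  if (⊤ : ℕ∞) ∈ C ∨ (∃ a ∈ C, ∃ b ∈ C, a ≠ b) ∨ (∃ k : ℕ, C = {(k : ℕ∞)} ∧ k ∈ S) then ⊤
  else if h : ∃ k : ℕ, C = {(k : ℕ∞)} ∧ k ∉ S then (h.choose : ℕ∞)
  else ((sInf {k : ℕ | k ∉ S} : ℕ) : ℕ∞)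

theorem gN_succ (n : ℕ) (L : Component) :
    gN (n + 1) L = extendedMex {k | ∃ L', QuietOption L L' ∧ gN n L' = (k : ℕ∞)}
      {v | ∃ L', CarryOption L L' ∧ gN n L' = v} := rfl

theorem extendedMex_empty : extendedMex ∅ ∅ = 0 := by
  have h (k : ℕ) : (∅ : Set ℕ∞) ≠ {(k : ℕ∞)} := (Set.singleton_ne_empty _).symm
  simp [extendedMex, h]

theorem gN_nil (n : ℕ) : gN n [] = 0 := by
  cases n with
  | zero => rfl
  | succ n => simp [gN_succ, QuietOption, CarryOption, extendedMex_empty]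

theorem gN_eq_gN {m n : ℕ} {L : Component} (hm : L.length ≤ m) (hn : L.length ≤ n) :
    gN m L = gN n L := by
  induction m generalizing n L with
  | zero =>
    obtain rfl : L = [] := List.length_eq_zero_iff.mp (Nat.le_zero.mp hm)
    rw [gN_nil, gN_nil]
  | succ m ih =>
    cases n with
    | zero =>
      obtain rfl : L = [] := List.length_eq_zero_iff.mp (Nat.le_zero.mp hn)
      rw [gN_nil, gN_nil]
    | succ n =>
      have ih' {L' : Component} (h : L'.length < L.length) : gN m L' = gN n L' :=
        ih (by omega) (by omega)
      rw [gN_succ, gN_succ]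
      congr 1
      · ext k
        exact exists_congr fun L' => and_congr_right fun h => by rw [ih' h.length_lt]
      · ext v
        exact exists_congr fun L' => and_congr_right fun h => by rw [ih' h.length_lt]

theorem g_eq_extendedMex (L : Component) :
    g L = extendedMex {k | ∃ L', QuietOption L L' ∧ g L' = (k : ℕ∞)}
      {v | ∃ L', CarryOption L L' ∧ g L' = v} := by
  rw [g, gN_eq_gN le_rfl (Nat.le_succ _), gN_succ]
  congr 1
  · ext k
    refine exists_congr fun L' => and_congr_right fun h => ?_
    rw [g, gN_eq_gN h.length_lt.le le_rfl]
  · ext v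
    refine exists_congr fun L' => and_congr_right fun h => ?_
    rw [g, gN_eq_gN h.length_lt.le le_rfl]

theorem extendedMex_eq_top {S : Set ℕ} {C : Set ℕ∞} (h : extendedMex S C = ⊤) :
    ⊤ ∈ C ∨ (∃ a ∈ C, ∃ b ∈ C, a ≠ b) ∨ (∃ k : ℕ, C = {(k : ℕ∞)} ∧ k ∈ S) := by
  unfold extendedMex at h
  split_ifs at h with h₁ h₂
  · exact h₁
  · exact absurd h (ENat.natCast_ne_top _)
  · exact absurd h (ENat.natCast_ne_top _)

theorem extendedMex_eq_coe {S : Set ℕ} (hS : S.Finite) {C : Set ℕ∞} {n : ℕ}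
    (h : extendedMex S C = n) :
    n ∉ S ∧ (C = {(n : ℕ∞)} ∨ C = ∅ ∧ ∀ k < n, k ∈ S) := by
  unfold extendedMex at h
  split_ifs at h with h₁ h₂
  · exact absurd h.symm (ENat.natCast_ne_top _)
  · have hspec := h₂.choose_spec
    rw [Nat.cast_inj.mp h] at hspec
    exact ⟨hspec.2, Or.inl hspec.1⟩
  · obtain rfl := Nat.cast_inj.mp h
    refine ⟨Nat.sInf_mem hS.infinite_compl.nonempty, Or.inr ⟨?_, fun k hk => ?_⟩⟩
    · push Not at h₁ h₂
      by_contra hC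
      obtain ⟨a, ha⟩ := Set.nonempty_iff_ne_empty.mpr hC
      lift a to ℕ using fun hat => h₁.1 (hat ▸ ha)
      have hCa : C = {(a : ℕ∞)} :=
        Set.eq_singleton_iff_unique_mem.mpr ⟨ha, fun b hb => h₁.2.1 b hb a ha⟩
      exact h₁.2.2 a hCa (h₂ a hCa)
    · by_contra hkS
      exact Nat.notMem_of_lt_sInf hk hkS

theorem exists_options_of_g_eq_top {L : Component} (h : g L = ⊤) :
    (∃ L', CarryOption L L' ∧ g L' = ⊤) ∨
    (∃ L₁ L₂, CarryOption L L₁ ∧ CarryOption L L₂ ∧ g L₁ ≠ g L₂) ∨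
    (∃ L₁ L₂, CarryOption L L₁ ∧ QuietOption L L₂ ∧ g L₁ = g L₂) := by
  rw [g_eq_extendedMex] at h
  rcases extendedMex_eq_top h with h | ⟨-, ⟨L₁, h₁, rfl⟩, -, ⟨L₂, h₂, rfl⟩, hne⟩ |
    ⟨k, hC, L₂, h₂, hk⟩
  · exact Or.inl h
  · exact Or.inr (Or.inl ⟨L₁, L₂, h₁, h₂, hne⟩)
  · obtain ⟨L₁, h₁, hk₁⟩ := hC.ge rfl
    exact Or.inr (Or.inr ⟨L₁, L₂, h₁, h₂, hk₁.trans hk.symm⟩)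

theorem options_of_g_eq_coe {L : Component} {n : ℕ} (h : g L = n) :
    (∀ L', QuietOption L L' → g L' ≠ n) ∧ (∀ L', CarryOption L L' → g L' = n) ∧
    ((∃ L', CarryOption L L' ∧ g L' = n) ∨ ∀ k < n, ∃ L', QuietOption L L' ∧ g L' = k) := by
  rw [g_eq_extendedMex] at h
  have hS : {k : ℕ | ∃ L', QuietOption L L' ∧ g L' = (k : ℕ∞)}.Finite := by
    refine ((finite_quietOption L).image fun L' => (g L').toNat).subset ?_
    rintro k ⟨L', hL', hk⟩
    exact ⟨L', hL', by simp [hk]⟩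
  obtain ⟨hn, hC | ⟨hC, hlt⟩⟩ := extendedMex_eq_coe hS h
  · exact ⟨fun L' hL' he => hn ⟨L', hL', he⟩, fun L' hL' => hC.le ⟨L', hL', rfl⟩,
      Or.inl (hC.ge rfl)⟩
  · exact ⟨fun L' hL' he => hn ⟨L', hL', he⟩, fun L' hL' => (hC.le ⟨L', hL', rfl⟩).elim,
      Or.inr hlt⟩

theorem winN_succ_pair (n : ℕ) (L M : Component) :
    WinN (n + 1) {L, M} ↔
      ((∃ L', QuietOption L L' ∧ ¬ WinN n {L', M}) ∨
        ∃ L', CarryOption L L' ∧ WinN n {L', M}) ∨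
      ((∃ M', QuietOption M M' ∧ ¬ WinN n {M', L}) ∨
        ∃ M', CarryOption M M' ∧ WinN n {M', L}) := by
  have hL : ({L, M} : Position).erase L = {M} := by simp [Multiset.insert_eq_cons]
  have hM : ({L, M} : Position).erase M = {L} := by
    rw [Multiset.pair_comm]
    simp [Multiset.insert_eq_cons]
  simp only [WinN, Multiset.insert_eq_cons, Multiset.mem_cons, Multiset.mem_singleton,
    or_and_right, exists_or, exists_eq_left] at hL hM ⊢
  rw [hL, hM]
  exact or_or_or_comm

/-- With enough fuel, the mover wins a pair exactly when the values differ or are infinite. -/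
theorem winN_pair_iff {n : ℕ} {L M : Component} (hn : L.length + M.length ≤ n) :
    WinN n {L, M} ↔ g L ≠ g M ∨ g L = ⊤ := by
  induction n generalizing L M with
  | zero =>
    obtain ⟨hL, hM⟩ := Nat.add_eq_zero_iff.mp (Nat.le_zero.mp hn)
    obtain rfl := List.length_eq_zero_iff.mp hL
    obtain rfl := List.length_eq_zero_iff.mp hM
    simp [WinN, g, gN_nil]
  | succ n ih =>
    have quiet {L M L' : Component} (hn : L.length + M.length ≤ n + 1) (h : QuietOption L L') :
        WinN n {L', M} ↔ g L' ≠ g M ∨ g L' = ⊤ := ih (by have := h.length_lt; omega)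
    have carry {L M L' : Component} (hn : L.length + M.length ≤ n + 1) (h : CarryOption L L') :
        WinN n {L', M} ↔ g L' ≠ g M ∨ g L' = ⊤ := ih (by have := h.length_lt; omega)
    have top {L M : Component} (hn : L.length + M.length ≤ n + 1) (h : g L = ⊤) :
        WinN (n + 1) {L, M} := by
      rw [winN_succ_pair]
      left
      by_cases hwin : ∃ L', CarryOption L L' ∧ WinN n {L', M}
      · exact Or.inr hwin
      have hcarry {L' : Component} (h' : CarryOption L L') : g L' = g M ∧ g L' ≠ ⊤ := by
        have : ¬ WinN n {L', M} := fun hw => hwin ⟨L', h', hw⟩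
        rwa [carry hn h', not_or, not_not] at this
      rcases exists_options_of_g_eq_top h with ⟨L', h', ht⟩ | ⟨L₁, L₂, h₁, h₂, hne⟩ |
        ⟨L₁, L₂, h₁, h₂, he⟩
      · exact absurd ht (hcarry h').2
      · exact absurd ((hcarry h₁).1.trans (hcarry h₂).1.symm) hne
      · refine Or.inl ⟨L₂, h₂, ?_⟩
        rw [quiet hn h₂, not_or, not_not, ← he]
        exact hcarry h₁
    have lower {L M : Component} (hn : L.length + M.length ≤ n + 1) {i s : ℕ} (his : i < s)
        (hL : g L = s) (hM : g M = i) : WinN (n + 1) {L, M} := by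
      rw [winN_succ_pair]
      left
      rcases (options_of_g_eq_coe hL).2.2 with ⟨L', h', hs⟩ | hlt
      · refine Or.inr ⟨L', h', (carry hn h').mpr (Or.inl ?_)⟩
        rw [hs, hM, Ne, Nat.cast_inj]
        exact his.ne'
      · obtain ⟨L', h', hi⟩ := hlt i his
        refine Or.inl ⟨L', h', ?_⟩
        rw [quiet hn h', hi, hM]
        simp
    have balanced {L M : Component} (hn : L.length + M.length ≤ n + 1) {i : ℕ}
        (hL : g L = i) (hM : g M = i) :
        ¬ ((∃ L', QuietOption L L' ∧ ¬ WinN n {L', M}) ∨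
          ∃ L', CarryOption L L' ∧ WinN n {L', M}) := by
      obtain ⟨hquiet, hcarry, -⟩ := options_of_g_eq_coe hL
      rintro (⟨L', h', hw⟩ | ⟨L', h', hw⟩)
      · exact hw ((quiet hn h').mpr (Or.inl (hM ▸ hquiet L' h')))
      · rw [carry hn h', hcarry L' h', hM] at hw
        simp at hw
    have hn' : M.length + L.length ≤ n + 1 := by omega
    by_cases hL : g L = ⊤
    · exact iff_of_true (top hn hL) (Or.inr hL)
    by_cases hM : g M = ⊤
    · exact iff_of_true (Multiset.pair_comm M L ▸ top hn' hM) (Or.inl (hM ▸ hL))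
    obtain ⟨a, ha⟩ := ENat.ne_top_iff_exists.mp hL
    obtain ⟨b, hb⟩ := ENat.ne_top_iff_exists.mp hM
    rcases lt_trichotomy a b with hab | rfl | hab
    · refine iff_of_true (Multiset.pair_comm M L ▸ lower hn' hab hb.symm ha.symm) (Or.inl ?_)
      rw [← ha, ← hb, Ne, Nat.cast_inj]
      exact hab.ne
    · refine iff_of_false ?_ (by simp [← ha, ← hb])
      rw [winN_succ_pair]
      exact not_or.mpr ⟨balanced hn ha.symm hb.symm, balanced hn' hb.symm ha.symm⟩
    · refine iff_of_true (lower hn hab ha.symm hb.symm) (Or.inl ?_)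
      rw [← ha, ← hb, Ne, Nat.cast_inj]
      exact hab.ne'

/-- If `L` and `M` are bulb-headed components with finite extended
Grundy values `i < s`, then the player to move wins the two-component position
`{L, M}`. -/
theorem stmt5 (i s : ℕ) (his : i < s) (L M : Component)
    (hL : BulbHeaded L) (hgL : g L = (i : ℕ∞))
    (hM : BulbHeaded M) (hgM : g M = (s : ℕ∞)) :
    Win {L, M} := by
  rw [Win, winN_pair_iff (by simp [Position.size]), hgL, hgM, Ne, Nat.cast_inj]
  exact Or.inl his.ne
end
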